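/- Let n, m be positive integers and let (k_t)_{t≥1} be a countable collection of weight vectors k_t = (k_{1,t},…,k_{n,t}). Let Θ ∈ ⋂_{t≥1} Bad(k_t,n,m) and let C ⊂ ℝⁿ be an everywhere non-degenerate C¹ curve. Then the Hausdorff dimension of ⋂_{t≥1} Bad_Θ(k_t,n,m) ∩ C equals 1. -/

import Mathlib

open Real MeasureTheory Topology

/-- Distance from a real number to the nearest integer. -/
noncomputable def distNearestInt (y : ℝ) : ℝ := ⨅ p : ℤ, |y - (p : ℝ)|

/-- `Θᵢ(q) = ∑ⱼ qⱼ Θᵢⱼ` : the `i`-th linear form of `Θ` evaluated at `q ∈ ℤᵐ`. -/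
noncomputable def linForm {n m : ℕ} (Θ : Matrix (Fin n) (Fin m) ℝ) (q : Fin m → ℤ)
    (i : Fin n) : ℝ := ∑ j, (q j : ℝ) * Θ i j

/-- `Θ*ⱼ(u) = ∑ᵢ uᵢ Θᵢⱼ` : the `j`-th linear form of the transposed matrix `Θ*`. -/
noncomputable def dualForm {n m : ℕ} (Θ : Matrix (Fin n) (Fin m) ℝ) (u : Fin n → ℤ)
    (j : Fin m) : ℝ := ∑ i, (u i : ℝ) * Θ i j

/-- The supremum norm `|q|` of an integer vector. -/
noncomputable def supNorm {m : ℕ} (q : Fin m → ℤ) : ℝ := ⨆ j, |(q j : ℝ)|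

/-- A weight vector: positive entries summing to 1. -/
def IsWeight {n : ℕ} (k : Fin n → ℝ) : Prop := (∀ i, 0 < k i) ∧ ∑ i, k i = 1

/-- The set `Bad(k,n,m)` of weighted badly approximable `n × m` matrices:
`inf_{q ∈ ℤᵐ, q ≠ 0} max_{1≤i≤n} |q|^{m kᵢ} ‖Θᵢ(q)‖ > 0`. -/
def Bad (n m : ℕ) (k : Fin n → ℝ) : Set (Matrix (Fin n) (Fin m) ℝ) :=
  {Θ | ∃ c > 0, ∀ q : Fin m → ℤ, q ≠ 0 →
    c ≤ ⨆ i, supNorm q ^ ((m : ℝ) * k i) * distNearestInt (linForm Θ q i)}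

/-- The twisted set `Bad_Θ(k,n,m)`:
`{x ∈ ℝⁿ : inf_{q ∈ ℤᵐ, q ≠ 0} max_{1≤i≤n} |q|^{m kᵢ} ‖Θᵢ(q) − xᵢ‖ > 0}`. -/
def BadT (n m : ℕ) (k : Fin n → ℝ) (Θ : Matrix (Fin n) (Fin m) ℝ) : Set (Fin n → ℝ) :=
  {x | ∃ c > 0, ∀ q : Fin m → ℤ, q ≠ 0 →
    c ≤ ⨆ i, supNorm q ^ ((m : ℝ) * k i) * distNearestInt (linForm Θ q i - x i)}

/-- A set `E` of reals that a player can force, in any game of nested intervals whose lengths start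
at least at `ρ`, tend to `0` and drop by a factor of at most `Γ` at each turn, by choosing from each
interval `[u, u + r]` a point whose `ε r`-neighbourhood is then avoided. -/
def AvoidanceWinning (E : Set ℝ) : Prop :=
  ∀ ε > 0, ∀ Γ : ℝ, ∀ ρ > 0, ∃ A : ℝ → ℝ → ℝ, ∀ (x : ℝ) (u r : ℕ → ℝ),
    (∀ j, x ∈ Set.Icc (u j) (u j + r j)) → ρ ≤ r 0 → (∀ j, r j ≤ Γ * r (j + 1)) →
    Filter.Tendsto r Filter.atTop (𝓝 0) → (∀ j, ε * r j ≤ |x - A (u j) (r j)|) → x ∈ E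

/-- Among `D + 1` alternate subintervals of `[u, u + r]`, some `D` stay away from `α`. -/
lemma exists_separated_subintervals (D : ℕ) (u r α : ℝ) (hr : 0 ≤ r) :
    ∃ c : Fin D → ℝ, ∀ e, u ≤ c e ∧ c e + r / (2 * D + 1) ≤ u + r ∧
      (∀ y ∈ Set.Icc (c e) (c e + r / (2 * D + 1)), r / (2 * D + 1) / 2 ≤ |y - α|) ∧
      ∀ e', e ≠ e' → 2 * (r / (2 * D + 1)) ≤ |c e - c e'| := by
  set h := r / (2 * D + 1) with hh
  have hD : (0 : ℝ) < 2 * D + 1 := by positivity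
  have hh0 : 0 ≤ h := by positivity
  have hrh : r = (2 * D + 1) * h := by rw [hh]; field_simp
  have hgap : ∀ i j : Fin (D + 1), i < j → 2 * h ≤ 2 * (j : ℕ) * h - 2 * (i : ℕ) * h := by
    intro i j hij
    have : ((i : ℕ) : ℝ) + 1 ≤ (j : ℕ) := by exact_mod_cast hij
    nlinarith
  let near : Fin (D + 1) → Prop := fun i =>
    ∃ y ∈ Set.Icc (u + 2 * (i : ℕ) * h) (u + 2 * (i : ℕ) * h + h), |y - α| < h / 2
  have huniq : ∀ i j, near i → near j → ¬ i < j := by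
    rintro i j ⟨y, hy, hya⟩ ⟨z, hz, hza⟩ hij
    have := hgap i j hij
    rw [abs_lt] at hya hza
    linarith [hy.1, hy.2, hz.1, hz.2]
  obtain ⟨b, hb⟩ : ∃ b, ∀ i, near i → i = b := by
    by_cases H : ∃ b, near b
    · obtain ⟨b, hb⟩ := H
      exact ⟨b, fun i hi => le_antisymm (not_lt.1 (huniq b i hb hi)) (not_lt.1 (huniq i b hi hb))⟩
    · exact ⟨0, fun i hi => (H ⟨i, hi⟩).elim⟩
  refine ⟨fun e => u + 2 * (b.succAbove e : ℕ) * h, fun e => ⟨?_, ?_, ?_, ?_⟩⟩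
  · have : 0 ≤ 2 * ((b.succAbove e : ℕ) : ℝ) * h := by positivity
    linarith
  · have : ((b.succAbove e : ℕ) : ℝ) ≤ D := by exact_mod_cast (b.succAbove e).is_le
    rw [hrh]
    nlinarith
  · intro y hy
    by_contra! hlt
    exact b.succAbove_ne e (hb _ ⟨y, hy, hlt⟩)
  · intro e' hne
    have hne' : b.succAbove e ≠ b.succAbove e' := fun h => hne (Fin.succAbove_right_injective h)
    rcases lt_or_gt_of_ne hne' with hlt | hlt
    · have := hgap _ _ hlt
      rw [abs_sub_comm]
      exact le_trans (by linarith) (le_abs_self _)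
    · have := hgap _ _ hlt
      exact le_trans (by linarith) (le_abs_self _)

/-- Countably many avoidance-winning sets jointly contain a Cantor set with `D` digits and
contraction ratio `1 / (2 D + 1)`, uniformly separated. -/
lemma exists_cantor_parametrization {E : ℕ → Set ℝ} (hE : ∀ t, AvoidanceWinning (E t)) {a b : ℝ}
    (hab : a < b) {D : ℕ} (hD : 1 ≤ D) :
    ∃ ψ : (ℕ → Fin D) → ℝ, (∀ e, ψ e ∈ (⋂ t, E t) ∩ Set.Icc a b) ∧
      ∀ e e' n, (∀ i < n, e i = e' i) → e n ≠ e' n →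
        (b - a) / (2 * D + 1) ^ (n + 1) ≤ |ψ e - ψ e'| := by
  set K : ℝ := 2 * D + 1 with hK
  have hD' : (1 : ℝ) ≤ D := by exact_mod_cast hD
  have hK1 : 1 < K := by linarith
  have hK0 : 0 < K := by linarith
  set r : ℕ → ℝ := fun j => (b - a) / K ^ j with hr
  have hba : 0 < b - a := sub_pos.2 hab
  have hr0 : ∀ j, 0 < r j := fun j => by positivity
  have hrs : ∀ j, r (j + 1) = r j / K := fun j => by simp only [hr, pow_succ]; field_simp
  have hradd : ∀ i j, r j = K ^ i * r (j + i) := fun i j => by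
    simp only [hr, pow_add]; field_simp
  have hrlim : Filter.Tendsto r Filter.atTop (𝓝 0) := by
    have := (tendsto_pow_atTop_nhds_zero_of_lt_one (r := K⁻¹) (by positivity)
      (inv_lt_one_of_one_lt₀ hK1)).const_mul (b - a)
    simpa [hr, div_eq_mul_inv] using this
  -- the `j`-th turn devoted to the set `E t`
  let turn : ℕ → ℕ → ℕ := fun t j => 2 ^ t * (2 * j + 1)
  have hturn : ∀ t j, padicValNat 2 (turn t j) = t := by
    intro t j
    have : padicValNat 2 (2 * j + 1) = 0 := padicValNat.eq_zero_of_not_dvd (by omega)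
    simp only [turn]
    rw [padicValNat.mul (by positivity) (by omega), padicValNat.prime_pow, this, add_zero]
  choose A hA using fun t => hE t (1 / (2 * K)) (by positivity) (K ^ (2 ^ (t + 1)))
    (r (turn t 0)) (hr0 _)
  choose c hc using fun u (j : ℕ) α => exists_separated_subintervals D u (r j) α (hr0 j).le
  let U : (ℕ → Fin D) → ℕ → ℝ := fun e j =>
    Nat.rec a (fun i u => c u i (A (padicValNat 2 i) u (r i)) (e i)) j
  have hU : ∀ e j, U e (j + 1) = c (U e j) j (A (padicValNat 2 j) (U e j) (r j)) (e j) :=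
    fun e j => rfl
  have hmono : ∀ e, Monotone (U e) := fun e => monotone_nat_of_le_succ fun j => by
    rw [hU]; exact (hc _ _ _ _).1
  have hanti : ∀ e, Antitone (fun j => U e j + r j) := fun e => antitone_nat_of_succ_le fun j => by
    rw [hU, hrs]; exact (hc _ _ _ _).2.1
  have hmem : ∀ e j, (⨆ i, U e i) ∈ Set.Icc (U e j) (U e j + r j) := fun e j => by
    have := (hmono e).ciSup_mem_iInter_Icc_of_antitone (hanti e) (fun i => by
      simpa using (hr0 i).le)
    exact Set.mem_iInter.1 this j
  refine ⟨fun e => ⨆ i, U e i, fun e => ⟨Set.mem_iInter.2 fun t => ?_, ?_⟩, ?_⟩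
  · refine hA t _ (fun j => U e (turn t j)) (fun j => r (turn t j)) (fun j => hmem e _) le_rfl
      (fun j => ?_) (hrlim.comp (Filter.tendsto_atTop_mono (fun j => ?_) Filter.tendsto_id))
      (fun j => ?_)
    · have : turn t (j + 1) = turn t j + 2 ^ (t + 1) := by simp only [turn]; ring
      rw [this, ← hradd]
    · have : 1 ≤ 2 ^ t := Nat.one_le_two_pow
      simp only [turn, id]
      nlinarith
    · have h1 := hmem e (turn t j + 1)
      rw [hU, hrs] at h1
      have h2 := (hc _ _ _ _).2.2.1 _ h1
      rw [hturn] at h2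
      refine le_trans (le_of_eq ?_) h2
      rw [← hK]
      field_simp
  · have := hmem e 0
    simpa [U, hr] using this
  · intro e e' n heq hne
    have hUeq : ∀ j ≤ n, U e j = U e' j := by
      intro j
      induction j with
      | zero => intro _; rfl
      | succ j ih =>
        intro hj
        rw [hU, hU, ih (by omega), heq j (by omega)]
    have h1 := hmem e (n + 1)
    have h2 := hmem e' (n + 1)
    rw [hU, hrs] at h1 h2
    rw [hUeq n le_rfl] at h1
    have h3 := (hc (U e' n) n (A (padicValNat 2 n) (U e' n) (r n)) (e n)).2.2.2 (e' n) hne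
    rw [← hK] at h3
    change r (n + 1) ≤ _
    rw [hrs]
    rcases le_abs.1 h3 with h | h
    · exact le_trans (by linarith [h1.1, h2.2]) (le_abs_self _)
    · exact le_trans (by linarith [h2.1, h1.2]) (neg_le_abs _)

lemma exists_nat_rpow_le {d : ℝ} (hd0 : 0 < d) (hd : d < 1) :
    ∃ D : ℕ, 2 ≤ D ∧ (2 * (D : ℝ) + 1) ^ d ≤ D := by
  have h1 : Filter.Tendsto (fun D : ℕ => (D : ℝ) ^ (1 - d)) Filter.atTop Filter.atTop :=
    (tendsto_rpow_atTop (sub_pos.2 hd)).comp tendsto_natCast_atTop_atTop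
  obtain ⟨D, hD, hD2⟩ := ((h1.eventually_ge_atTop ((3 : ℝ) ^ d)).and
    (Filter.eventually_ge_atTop 2)).exists
  refine ⟨D, hD2, ?_⟩
  have hD' : (2 : ℝ) ≤ D := by exact_mod_cast hD2
  calc (2 * (D : ℝ) + 1) ^ d ≤ (3 * D) ^ d := by
        apply rpow_le_rpow (by positivity) (by linarith) hd0.le
    _ = 3 ^ d * (D : ℝ) ^ d := mul_rpow (by norm_num) (by positivity)
    _ ≤ (D : ℝ) ^ (1 - d) * (D : ℝ) ^ d := by gcongr
    _ = D := by rw [← rpow_add (by positivity)]; simp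

/-- A countable intersection of avoidance-winning sets has full dimension in each interval. -/
lemma one_le_dimH_iInter_of_avoidanceWinning {E : ℕ → Set ℝ} (hE : ∀ t, AvoidanceWinning (E t))
    {a b : ℝ} (hab : a < b) : 1 ≤ dimH ((⋂ t, E t) ∩ Set.Icc a b) := by
  refine le_of_forall_lt_imp_le_of_dense fun d' hd' => ?_
  lift d' to NNReal using (hd'.trans ENNReal.one_lt_top).ne
  rcases eq_or_ne d' 0 with rfl | hd0
  · simp
  have hd0 : 0 < d' := pos_iff_ne_zero.2 hd0
  have hd0' : (0 : ℝ) < d' := hd0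
  have hd1 : (d' : ℝ) < 1 := by exact_mod_cast hd'
  obtain ⟨D, hD2, hD⟩ := exists_nat_rpow_le hd0' hd1
  obtain ⟨ψ, hψ, hsep⟩ := exists_cantor_parametrization hE hab (D := D) (by omega)
  have hD' : (2 : ℝ) ≤ D := by exact_mod_cast hD2
  have hba : 0 < b - a := sub_pos.2 hab
  set K : ℝ := 2 * D + 1 with hK
  have hK0 : 0 < K := by positivity
  have hbound : ∀ e e', dist (ofDigits e) (ofDigits e') ≤
      (D * ((b - a) ^ (d' : ℝ))⁻¹) * dist (ψ e) (ψ e') ^ (d' : ℝ) := by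
    intro e e'
    by_cases hee : e = e'
    · subst hee
      simp [zero_rpow hd0'.ne']
    have hex : ∃ i, e i ≠ e' i := Function.ne_iff.1 hee
    classical
    set N := Nat.find hex
    have hlt : ∀ i < N, e i = e' i := fun i hi => not_not.1 (Nat.find_min hex hi)
    have h1 := abs_ofDigits_sub_ofDigits_le hlt
    have h2 := hsep e e' N hlt (Nat.find_spec hex)
    rw [Real.dist_eq, Real.dist_eq]
    have h3 : (b - a) ^ (d' : ℝ) / (D : ℝ) ^ (N + 1) ≤ |ψ e - ψ e'| ^ (d' : ℝ) := by
      calc (b - a) ^ (d' : ℝ) / (D : ℝ) ^ (N + 1)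
          ≤ (b - a) ^ (d' : ℝ) / (K ^ (d' : ℝ)) ^ (N + 1) := by gcongr
        _ = ((b - a) / K ^ (N + 1)) ^ (d' : ℝ) := by
            rw [div_rpow hba.le (by positivity), ← rpow_natCast, ← rpow_natCast,
              ← rpow_mul hK0.le, ← rpow_mul hK0.le, mul_comm]
        _ ≤ _ := rpow_le_rpow (by positivity) h2 hd0'.le
    refine h1.trans ?_
    calc ((D : ℝ) ^ N)⁻¹
        = (D * ((b - a) ^ (d' : ℝ))⁻¹) * ((b - a) ^ (d' : ℝ) / (D : ℝ) ^ (N + 1)) := by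
          have : (b - a) ^ (d' : ℝ) ≠ 0 := by positivity
          rw [pow_succ]
          field_simp
      _ ≤ _ := by gcongr
  have hψinj : Function.Injective ψ := by
    intro e e' h
    by_contra hee
    have hex : ∃ i, e i ≠ e' i := Function.ne_iff.1 hee
    classical
    have h2 := hsep e e' (Nat.find hex) (fun i hi => not_not.1 (Nat.find_min hex hi))
      (Nat.find_spec hex)
    rw [h, sub_self, abs_zero] at h2
    have : 0 < (b - a) / K ^ (Nat.find hex + 1) := by positivity
    linarith
  have : Nonempty (ℕ → Fin D) := ⟨fun _ => ⟨0, by omega⟩⟩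
  let g : ℝ → ℝ := ofDigits ∘ Function.invFun ψ
  have hg : ∀ e, g (ψ e) = ofDigits e := fun e => by
    simp [g, Function.leftInverse_invFun hψinj e]
  have hC : 0 ≤ D * ((b - a) ^ (d' : ℝ))⁻¹ := by positivity
  have hHolder : HolderOnWith ⟨_, hC⟩ d' g (Set.range ψ) := by
    rintro _ ⟨e, rfl⟩ _ ⟨e', rfl⟩
    rw [hg, hg, edist_dist, edist_dist, ENNReal.ofReal_rpow_of_nonneg dist_nonneg hd0'.le]
    refine (ENNReal.ofReal_le_ofReal (hbound e e')).trans (le_of_eq ?_)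
    rw [ENNReal.ofReal_mul hC]
    congr 1
    exact ENNReal.ofReal_eq_coe_nnreal hC
  have hsub : Set.Icc (0 : ℝ) 1 ⊆ g '' Set.range ψ := by
    intro y hy
    obtain ⟨e, -, rfl⟩ := ofDigits_SurjOn (b := D) (by omega) hy
    exact ⟨ψ e, ⟨e, rfl⟩, hg e⟩
  have hIcc : dimH (Set.Icc (0 : ℝ) 1) = 1 := by
    rw [Real.dimH_of_nonempty_interior (by simp)]
    simp
  have h1 : 1 ≤ dimH (Set.range ψ) / d' := by
    rw [← hIcc]
    exact (dimH_mono hsub).trans (hHolder.dimH_image_le hd0)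
  have h2 : (d' : ENNReal) ≤ dimH (Set.range ψ) := by
    rw [ENNReal.le_div_iff_mul_le (by simp [hd0.ne']) (by simp), one_mul] at h1
    exact h1
  exact h2.trans (dimH_mono (Set.range_subset_iff.2 hψ))

lemma distNearestInt_le (y : ℝ) (p : ℤ) : distNearestInt y ≤ |y - p| :=
  ciInf_le ⟨0, by rintro _ ⟨p, rfl⟩; exact abs_nonneg _⟩ p

lemma distNearestInt_nonneg (y : ℝ) : 0 ≤ distNearestInt y :=
  Real.iInf_nonneg fun _ => abs_nonneg _

lemma abs_le_supNorm {m : ℕ} (q : Fin m → ℤ) (j : Fin m) : |(q j : ℝ)| ≤ supNorm q :=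
  le_ciSup (f := fun j => |(q j : ℝ)|) (Set.finite_range _).bddAbove j

lemma supNorm_nonneg {m : ℕ} (q : Fin m → ℤ) : 0 ≤ supNorm q :=
  Real.iSup_nonneg fun _ => abs_nonneg _

lemma one_le_supNorm {m : ℕ} {q : Fin m → ℤ} (hq : q ≠ 0) : 1 ≤ supNorm q := by
  obtain ⟨j, hj⟩ := Function.ne_iff.1 hq
  refine le_trans ?_ (abs_le_supNorm q j)
  exact_mod_cast Int.one_le_abs hj

lemma supNorm_sub_le {m : ℕ} (q q' : Fin m → ℤ) : supNorm (q - q') ≤ supNorm q + supNorm q' := by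
  refine Real.iSup_le (fun j => ?_) (add_nonneg (supNorm_nonneg q) (supNorm_nonneg q'))
  rw [Pi.sub_apply, Int.cast_sub]
  exact (abs_sub _ _).trans (add_le_add (abs_le_supNorm q j) (abs_le_supNorm q' j))

lemma linForm_sub {n m : ℕ} (Θ : Matrix (Fin n) (Fin m) ℝ) (q q' : Fin m → ℤ) (i : Fin n) :
    linForm Θ (q - q') i = linForm Θ q i - linForm Θ q' i := by
  simp [linForm, sub_mul, Finset.sum_sub_distrib]

/-- The integer vector `q` approximates the target `y` to within `c |q|^{-m kᵢ}` in each
coordinate. -/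
def Approximates {n m : ℕ} (k : Fin n → ℝ) (Θ : Matrix (Fin n) (Fin m) ℝ) (c : ℝ)
    (y : Fin n → ℝ) (q : Fin m → ℤ) (p : Fin n → ℤ) : Prop :=
  ∀ i, |linForm Θ q i - y i - p i| < c * supNorm q ^ (-((m : ℝ) * k i))

lemma exists_approximates_of_notMem_badT {n m : ℕ} {k : Fin n → ℝ}
    {Θ : Matrix (Fin n) (Fin m) ℝ} {c : ℝ} (hc : 0 < c) {y : Fin n → ℝ}
    (hy : y ∉ BadT n m k Θ) : ∃ q ≠ 0, ∃ p, Approximates k Θ c y q p := by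
  have : ¬ ∀ q : Fin m → ℤ, q ≠ 0 →
      c ≤ ⨆ i, supNorm q ^ ((m : ℝ) * k i) * distNearestInt (linForm Θ q i - y i) :=
    fun h => hy ⟨c, hc, h⟩
  push Not at this
  obtain ⟨q, hq, hlt⟩ := this
  have hS : 0 < supNorm q := zero_lt_one.trans_le (one_le_supNorm hq)
  have key : ∀ i, ∃ p : ℤ, |linForm Θ q i - y i - p| < c * supNorm q ^ (-((m : ℝ) * k i)) := by
    intro i
    apply exists_lt_of_ciInf_lt
    change distNearestInt _ < _
    rw [rpow_neg hS.le, ← div_eq_mul_inv, lt_div_iff₀ (by positivity), mul_comm]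
    exact (le_ciSup (f := fun i => supNorm q ^ ((m : ℝ) * k i) *
      distNearestInt (linForm Θ q i - y i)) (Set.finite_range _).bddAbove i).trans_lt hlt
  choose p hp using key
  exact ⟨q, hq, p, hp⟩

/-- Two good approximations, of comparable size, to two nearby targets coincide when `Θ` is badly
approximable. Here `w` plays the role of the scale `|q|^{-m max k}`. -/
lemma Approximates.unique {n m : ℕ} (hm : 0 < m) {k : Fin n → ℝ} (hk : IsWeight k) {i₀ : Fin n}
    (hi₀ : ∀ i, k i ≤ k i₀) {Θ : Matrix (Fin n) (Fin m) ℝ} {c₀ : ℝ}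
    (hΘ : ∀ q : Fin m → ℤ, q ≠ 0 →
      c₀ ≤ ⨆ i, supNorm q ^ ((m : ℝ) * k i) * distNearestInt (linForm Θ q i))
    {c G L w : ℝ} (hc : 0 ≤ c) (hG : 1 ≤ G) (hL : 0 ≤ L) (hw : 0 < w) (hw1 : w ≤ 1)
    (hsmall : 2 ^ m * (2 * c * G + L) < c₀) (hsmall' : 2 * c * G + L < 1)
    {q q' : Fin m → ℤ} (hq : q ≠ 0) (hq' : q' ≠ 0)
    (hqw : w * supNorm q ^ ((m : ℝ) * k i₀) ≤ 1) (hqw' : w * supNorm q' ^ ((m : ℝ) * k i₀) ≤ 1)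
    (hqG : 1 ≤ G * w * supNorm q ^ ((m : ℝ) * k i₀))
    (hqG' : 1 ≤ G * w * supNorm q' ^ ((m : ℝ) * k i₀))
    {y y' : Fin n → ℝ} (hyy : ∀ i, |y i - y' i| ≤ L * w) {p p' : Fin n → ℤ}
    (ha : Approximates k Θ c y q p) (ha' : Approximates k Θ c y' q' p') :
    |y i₀ - y' i₀| ≤ 2 * c * G * w := by
  have hm0 : (0 : ℝ) < m := by exact_mod_cast hm
  have hki₀ := hk.1 i₀
  have hτ : 0 < (m : ℝ) * k i₀ := by positivity
  set τ := (m : ℝ) * k i₀ with hτdef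
  have hkσ : ∀ i, (m : ℝ) * k i = τ * (k i / k i₀) := fun i => by rw [hτdef]; field_simp
  have hσ0 : ∀ i, 0 < k i / k i₀ := fun i => div_pos (hk.1 i) hki₀
  have hσ1 : ∀ i, k i / k i₀ ≤ 1 := fun i => (div_le_one hki₀).2 (hi₀ i)
  have hG0 : 0 < G := zero_lt_one.trans_le hG
  have hdecay : ∀ s : Fin m → ℤ, s ≠ 0 → 1 ≤ G * w * supNorm s ^ τ → ∀ i,
      supNorm s ^ (-((m : ℝ) * k i)) ≤ G * w ^ (k i / k i₀) := by
    intro s hs hsG i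
    have hS : 0 < supNorm s := zero_lt_one.trans_le (one_le_supNorm hs)
    have h1 : supNorm s ^ (-τ) ≤ G * w := by
      rw [rpow_neg hS.le]
      exact (inv_le_iff_one_le_mul₀ (by positivity)).2 hsG
    calc supNorm s ^ (-((m : ℝ) * k i)) = (supNorm s ^ (-τ)) ^ (k i / k i₀) := by
          rw [← rpow_mul hS.le, hkσ, neg_mul]
      _ ≤ (G * w) ^ (k i / k i₀) := rpow_le_rpow (by positivity) h1 (hσ0 i).le
      _ = G ^ (k i / k i₀) * w ^ (k i / k i₀) := mul_rpow hG0.le hw.le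
      _ ≤ G * w ^ (k i / k i₀) := by
          gcongr
          exact rpow_le_self_of_one_le hG (hσ1 i)
  have hgrowth : ∀ s : Fin m → ℤ, w * supNorm s ^ τ ≤ 1 → supNorm s ≤ w ^ (-(1 / τ)) := by
    intro s hsw
    have hS := supNorm_nonneg s
    calc supNorm s = (supNorm s ^ τ) ^ (1 / τ) := by
          rw [← rpow_mul hS, mul_one_div_cancel hτ.ne', rpow_one]
      _ ≤ (w⁻¹) ^ (1 / τ) := by
          apply rpow_le_rpow (by positivity) _ (by positivity)
          rw [← one_div, le_div_iff₀ hw, mul_comm]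
          exact hsw
      _ = w ^ (-(1 / τ)) := by rw [inv_rpow hw.le, rpow_neg hw.le]
  have hdiff : ∀ i, |linForm Θ q i - linForm Θ q' i - ((p i - p' i : ℤ) : ℝ)| ≤
      (2 * c * G + L) * w ^ (k i / k i₀) := by
    intro i
    have h1 := (ha i).le.trans (mul_le_mul_of_nonneg_left (hdecay q hq hqG i) hc)
    have h2 := (ha' i).le.trans (mul_le_mul_of_nonneg_left (hdecay q' hq' hqG' i) hc)
    have h3 : L * w ≤ L * w ^ (k i / k i₀) := by
      gcongr
      exact self_le_rpow_of_le_one hw.le hw1 (hσ1 i)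
    have h4 := (hyy i).trans h3
    push_cast
    rw [abs_le] at h1 h2 h4 ⊢
    constructor <;> linarith [h1.1, h1.2, h2.1, h2.2, h4.1, h4.2]
  have hqq : q = q' := by
    by_contra hne
    refine (hΘ (q - q') (sub_ne_zero.2 hne)).not_gt (lt_of_le_of_lt ?_ hsmall)
    have : Nonempty (Fin n) := ⟨i₀⟩
    refine ciSup_le fun i => ?_
    have hmk : (m : ℝ) * k i ≤ m := by
      have : k i ≤ 1 := by
        rw [← hk.2]
        exact Finset.single_le_sum (fun j _ => (hk.1 j).le) (Finset.mem_univ i)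
      nlinarith
    have hmk0 : 0 < (m : ℝ) * k i := mul_pos hm0 (hk.1 i)
    have h1 : supNorm (q - q') ^ ((m : ℝ) * k i) ≤ 2 ^ m * w ^ (-(k i / k i₀)) := by
      calc supNorm (q - q') ^ ((m : ℝ) * k i) ≤ (2 * w ^ (-(1 / τ))) ^ ((m : ℝ) * k i) := by
            apply rpow_le_rpow (supNorm_nonneg _) _ hmk0.le
            linarith [supNorm_sub_le q q', hgrowth q hqw, hgrowth q' hqw']
        _ = 2 ^ ((m : ℝ) * k i) * w ^ (-(k i / k i₀)) := by
            rw [mul_rpow (by norm_num) (by positivity), ← rpow_mul hw.le, hkσ i]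
            congr 2
            field_simp
        _ ≤ 2 ^ (m : ℝ) * w ^ (-(k i / k i₀)) := by
            gcongr
            norm_num
        _ = _ := by rw [rpow_natCast]
    have h2 : distNearestInt (linForm Θ (q - q') i) ≤ (2 * c * G + L) * w ^ (k i / k i₀) := by
      rw [linForm_sub]
      exact (distNearestInt_le _ _).trans (hdiff i)
    calc supNorm (q - q') ^ ((m : ℝ) * k i) * distNearestInt (linForm Θ (q - q') i)
        ≤ (2 ^ m * w ^ (-(k i / k i₀))) * ((2 * c * G + L) * w ^ (k i / k i₀)) := by
          gcongr
          exact distNearestInt_nonneg _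
      _ = 2 ^ m * (2 * c * G + L) := by
          rw [rpow_neg hw.le]
          have : w ^ (k i / k i₀) ≠ 0 := by positivity
          field_simp
  subst hqq
  have hpp : p i₀ = p' i₀ := by
    have h1 := hdiff i₀
    rw [sub_self, zero_sub, abs_neg, div_self hki₀.ne', rpow_one] at h1
    have h2 : |((p i₀ - p' i₀ : ℤ) : ℝ)| < 1 := by
      refine h1.trans_lt (lt_of_le_of_lt ?_ hsmall')
      exact mul_le_of_le_one_right (by positivity) hw1
    have h3 : |p i₀ - p' i₀| < 1 := by exact_mod_cast h2
    exact sub_eq_zero.1 (Int.abs_lt_one_iff.1 h3)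
  have h1 := (ha i₀).le.trans (mul_le_mul_of_nonneg_left (hdecay q hq hqG i₀) hc)
  have h2 := (ha' i₀).le.trans (mul_le_mul_of_nonneg_left (hdecay q hq hqG' i₀) hc)
  rw [div_self hki₀.ne', rpow_one, ← hpp] at *
  rw [abs_le] at h1 h2 ⊢
  constructor <;> linarith [h1.1, h1.2, h2.1, h2.2]

/-- The parameters of a curve, bi-Lipschitz in each coordinate, whose points lie in the twisted set
of a badly approximable matrix form an avoidance-winning set. -/
lemma avoidanceWinning_badT {n m : ℕ} (hn : 0 < n) (hm : 0 < m) {k : Fin n → ℝ} (hk : IsWeight k)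
    {Θ : Matrix (Fin n) (Fin m) ℝ} (hΘ : Θ ∈ Bad n m k) {s : Set ℝ} {f : ℝ → Fin n → ℝ} {μ M : ℝ}
    (hμ : 0 < μ) (hM : 0 < M)
    (hlow : ∀ x ∈ s, ∀ y ∈ s, ∀ i, μ * |x - y| ≤ |f x i - f y i|)
    (hupp : ∀ x ∈ s, ∀ y ∈ s, ∀ i, |f x i - f y i| ≤ M * |x - y|) :
    AvoidanceWinning {x | x ∈ s → f x ∈ BadT n m k Θ} := by
  intro ε hε Γ ρ hρ
  obtain ⟨c₀, hc₀, hΘ⟩ := hΘ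
  have : Nonempty (Fin n) := ⟨⟨0, hn⟩⟩
  obtain ⟨i₀, hi₀⟩ := Finite.exists_max k
  set G := max Γ 1
  have hG : 1 ≤ G := le_max_right _ _
  have hG0 : 0 < G := zero_lt_one.trans_le hG
  have hτ : 0 < (m : ℝ) * k i₀ := mul_pos (by exact_mod_cast hm) (hk.1 i₀)
  set τ := (m : ℝ) * k i₀
  set κ := min (c₀ / 2 ^ m) 1 / 4 with hκdef
  have hκ : 0 < κ := by positivity
  set δ := min (ρ / 2) (min 1 (κ / M))
  have hδ : 0 < δ := by positivity
  have hδρ : δ < ρ := (min_le_left _ _).trans_lt (by linarith)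
  have hδM : M * δ ≤ κ := by
    have : δ ≤ κ / M := (min_le_right _ _).trans (min_le_right _ _)
    rwa [le_div_iff₀ hM, mul_comm] at this
  set c := min (κ / (2 * G)) (ε * δ * μ / (4 * G))
  have hc : 0 < c := by positivity
  have hcκ : 2 * c * G ≤ κ := by
    have : c ≤ κ / (2 * G) := min_le_left _ _
    rw [le_div_iff₀ (by positivity)] at this
    linarith
  have hcε : 2 * c * G ≤ ε * δ * μ / 2 := by
    have : c ≤ ε * δ * μ / (4 * G) := min_le_right _ _
    rw [le_div_iff₀ (by positivity)] at this
    linarith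
  have hκ4 : 4 * κ ≤ c₀ / 2 ^ m := by rw [hκdef]; linarith [min_le_left (c₀ / 2 ^ m) 1]
  have hκ4' : 4 * κ ≤ 1 := by rw [hκdef]; linarith [min_le_right (c₀ / 2 ^ m) 1]
  have hsmall : 2 ^ m * (2 * c * G + M * δ) < c₀ := by
    rw [le_div_iff₀ (by positivity)] at hκ4
    have : (0 : ℝ) < 2 ^ m := by positivity
    nlinarith
  let Danger : ℝ → ℝ → Prop := fun r x => x ∈ s ∧ ∃ q : Fin m → ℤ, q ≠ 0 ∧
    r * supNorm q ^ τ ≤ δ ∧ δ ≤ G * r * supNorm q ^ τ ∧ ∃ p, Approximates k Θ c (f x) q p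
  have hclose : ∀ r x x', 0 < r → |x - x'| ≤ r → Danger r x → Danger r x' → |x - x'| < ε * r := by
    rintro r x x' hr hxx ⟨hx, q, hq, hqw, hqG, p, hp⟩ ⟨hx', q', hq', hqw', hqG', p', hp'⟩
    have hrδ : r ≤ δ := by
      refine le_trans (le_mul_of_one_le_right hr.le ?_) hqw
      exact one_le_rpow (one_le_supNorm hq) hτ.le
    have h1 := Approximates.unique hm hk hi₀ hΘ hc.le hG (L := M * δ) (w := r / δ) (by positivity)
      (by positivity) ((div_le_one hδ).2 hrδ) hsmall (by linarith) hq hq'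
      (by rw [div_mul_eq_mul_div, div_le_one hδ]; exact hqw)
      (by rw [div_mul_eq_mul_div, div_le_one hδ]; exact hqw')
      (by rw [mul_div_assoc', div_mul_eq_mul_div, one_le_div hδ]; exact hqG)
      (by rw [mul_div_assoc', div_mul_eq_mul_div, one_le_div hδ]; exact hqG')
      (fun i => (hupp x hx x' hx' i).trans (by
        rw [mul_assoc, mul_div_cancel₀ _ hδ.ne']; gcongr)) hp hp'
    have h2 := (hlow x hx x' hx' i₀).trans h1
    have h3 : 2 * c * G * (r / δ) ≤ ε * δ * μ / 2 * (r / δ) := by gcongr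
    have h4 : ε * δ * μ / 2 * (r / δ) = μ * (ε * r / 2) := by field_simp
    have h5 : |x - x'| ≤ ε * r / 2 := le_of_mul_le_mul_left ((h2.trans h3).trans_eq h4) hμ
    have : 0 < ε * r := by positivity
    linarith
  classical
  refine ⟨fun u r => if h : ∃ x ∈ Set.Icc u (u + r), Danger r x then h.choose else 0,
    fun x u r hmem hr0 hrΓ hrlim havoid hxs => ?_⟩
  by_contra hbad
  obtain ⟨q, hq, p, hp⟩ := exists_approximates_of_notMem_badT hc hbad
  have hS := one_le_supNorm hq
  have hrpos : ∀ j, 0 < r j := by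
    intro j
    induction j with
    | zero => exact hρ.trans_le hr0
    | succ j ih =>
      have h1 : 0 ≤ r (j + 1) := by linarith [(hmem (j + 1)).1, (hmem (j + 1)).2]
      refine h1.lt_of_ne fun h0 => ?_
      have := hrΓ j
      rw [← h0, mul_zero] at this
      linarith
  have hex : ∃ j, r j * supNorm q ^ τ ≤ δ := by
    have h1 := hrlim.mul_const (supNorm q ^ τ)
    rw [zero_mul] at h1
    obtain ⟨j, hj⟩ := (h1.eventually (ge_mem_nhds hδ)).exists
    exact ⟨j, hj⟩
  obtain ⟨j, hj⟩ : ∃ j, Nat.find hex = j + 1 := by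
    refine Nat.exists_eq_succ_of_ne_zero fun h0 => ?_
    have h1 := Nat.find_spec hex
    rw [h0] at h1
    have : r 0 ≤ r 0 * supNorm q ^ τ :=
      le_mul_of_one_le_right (hrpos 0).le (one_le_rpow hS hτ.le)
    linarith
  have hle := Nat.find_spec hex
  rw [hj] at hle
  have hgt := not_le.1 (Nat.find_min hex (m := j) (by omega))
  have hdanger : Danger (r (j + 1)) x := by
    refine ⟨hxs, q, hq, hle, hgt.le.trans ?_, p, hp⟩
    gcongr
    exact (hrΓ j).trans (mul_le_mul_of_nonneg_right (le_max_left _ _) (hrpos _).le)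
  have hH : ∃ z ∈ Set.Icc (u (j + 1)) (u (j + 1) + r (j + 1)), Danger (r (j + 1)) z :=
    ⟨x, hmem _, hdanger⟩
  have hav := havoid (j + 1)
  simp only [dif_pos hH] at hav
  obtain ⟨hz, hzd⟩ := hH.choose_spec
  refine hav.not_gt (hclose _ _ _ (hrpos _) ?_ hdanger hzd)
  have hx := hmem (j + 1)
  rw [abs_le]
  constructor <;> linarith [hx.1, hx.2, hz.1, hz.2]

/-- An everywhere non-degenerate `C¹` curve is bi-Lipschitz in each coordinate. -/
lemma exists_biLipschitz_coordinates {ι : Type*} [Fintype ι] {a b : ℝ} {f f' : ℝ → ι → ℝ}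
    (hderiv : ∀ x ∈ Set.Icc a b, HasDerivWithinAt f (f' x) (Set.Icc a b) x)
    (hcont : ContinuousOn f' (Set.Icc a b)) (hnd : ∀ x ∈ Set.Icc a b, ∀ i, f' x i ≠ 0) :
    ∃ μ > 0, ∃ M > 0, (∀ x ∈ Set.Icc a b, ∀ y ∈ Set.Icc a b, ∀ i,
      μ * |x - y| ≤ |f x i - f y i|) ∧
      ∀ x ∈ Set.Icc a b, ∀ y ∈ Set.Icc a b, ∀ i, |f x i - f y i| ≤ M * |x - y| := by
  have hci : ∀ i, ContinuousOn (fun x => |f' x i|) (Set.Icc a b) := fun i =>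
    ((continuous_apply i).comp_continuousOn hcont).abs
  have hlo : ∀ i, ∃ μ > 0, ∀ x ∈ Set.Icc a b, μ ≤ |f' x i| := fun i =>
    isCompact_Icc.exists_forall_le' (hci i) (a := 0) fun x hx => abs_pos.2 (hnd x hx i)
  have hhi : ∀ i, ∃ M, ∀ x ∈ Set.Icc a b, |f' x i| ≤ M := fun i => by
    obtain ⟨M, hM⟩ := isCompact_Icc.bddAbove_image (hci i)
    exact ⟨M, fun x hx => hM ⟨x, hx, rfl⟩⟩
  choose μ hμ hμle using hlo
  choose M hM using hhi
  obtain ⟨μ₀, hμ₀, hμ₀le⟩ : ∃ μ₀ > 0, ∀ i, μ₀ ≤ μ i := by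
    rcases isEmpty_or_nonempty ι with h | h
    · exact ⟨1, one_pos, fun i => h.elim i⟩
    · obtain ⟨i, hi⟩ := Finite.exists_min μ
      exact ⟨μ i, hμ i, hi⟩
  obtain ⟨M₀, hM₀⟩ := (Set.finite_range M).bddAbove
  have slope : ∀ x ∈ Set.Icc a b, ∀ y ∈ Set.Icc a b, x < y → ∀ i, ∃ z ∈ Set.Icc a b,
      |f x i - f y i| = |f' z i| * |x - y| := by
    intro x hx y hy hxy i
    have hsub : Set.Icc x y ⊆ Set.Icc a b := Set.Icc_subset_Icc hx.1 hy.2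
    have hd : ∀ z ∈ Set.Icc a b,
        HasDerivWithinAt (fun z => f z i) (f' z i) (Set.Icc a b) z := fun z hz =>
      hasDerivWithinAt_pi.1 (hderiv z hz) i
    obtain ⟨z, hz, hzeq⟩ := exists_hasDerivAt_eq_slope (fun z => f z i) (fun z => f' z i) hxy
      (fun z hz => ((hd z (hsub hz)).continuousWithinAt).mono hsub)
      (fun z hz => (hd z (hsub (Set.Ioo_subset_Icc_self hz))).hasDerivAt
        (Icc_mem_nhds (hx.1.trans_lt hz.1) (hz.2.trans_le hy.2)))
    refine ⟨z, hsub (Set.Ioo_subset_Icc_self hz), ?_⟩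
    rw [← abs_mul, hzeq]
    congr 1
    have : y - x ≠ 0 := sub_ne_zero.2 hxy.ne'
    field_simp
    ring
  have slope' : ∀ x ∈ Set.Icc a b, ∀ y ∈ Set.Icc a b, x ≠ y → ∀ i, ∃ z ∈ Set.Icc a b,
      |f x i - f y i| = |f' z i| * |x - y| := by
    intro x hx y hy hxy i
    rcases lt_or_gt_of_ne hxy with h | h
    · exact slope x hx y hy h i
    · rw [abs_sub_comm, abs_sub_comm x]
      exact slope y hy x hx h i
  refine ⟨μ₀, hμ₀, max M₀ 1, by positivity, ?_, ?_⟩ <;> intro x hx y hy i <;>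
    rcases eq_or_ne x y with rfl | hxy
  · simp
  · obtain ⟨z, hz, h⟩ := slope' x hx y hy hxy i
    rw [h]
    gcongr
    exact (hμ₀le i).trans (hμle i z hz)
  · simp
  · obtain ⟨z, hz, h⟩ := slope' x hx y hy hxy i
    rw [h]
    gcongr
    exact (hM i z hz).trans ((hM₀ ⟨i, rfl⟩).trans (le_max_left _ _))

/-- A map that is bi-Lipschitz on a set preserves its Hausdorff dimension. -/
lemma dimH_image_eq_of_biLipschitzOn {X Y : Type*} [MetricSpace X] [MetricSpace Y] {s : Set X}
    {f : X → Y} {μ M : ℝ} (hμ : 0 < μ)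
    (hlow : ∀ x ∈ s, ∀ y ∈ s, μ * dist x y ≤ dist (f x) (f y))
    (hupp : ∀ x ∈ s, ∀ y ∈ s, dist (f x) (f y) ≤ M * dist x y) : dimH (f '' s) = dimH s := by
  refine le_antisymm ?_ ?_
  · have : LipschitzOnWith M.toNNReal f s := LipschitzOnWith.of_dist_le_mul fun x hx y hy =>
      (hupp x hx y hy).trans (mul_le_mul_of_nonneg_right (le_coe_toNNReal M) dist_nonneg)
    exact this.dimH_image_le
  · have h : AntilipschitzWith (μ⁻¹).toNNReal (fun x : s => f x) :=
      AntilipschitzWith.of_le_mul_dist fun x y => by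
        rw [coe_toNNReal _ (by positivity), inv_mul_eq_div, le_div_iff₀ hμ, mul_comm]
        exact hlow x x.2 y y.2
    have h1 := h.le_dimH_image Set.univ
    have h2 : dimH (Set.univ : Set s) = dimH s := by
      rw [← (isometry_subtype_coe (s := s)).dimH_image, Set.image_univ, Subtype.range_coe]
    rwa [h2, Set.image_univ, ← Set.image_eq_range] at h1

/-- For a countable collection of weight vectors `kₜ`, if
`Θ ∈ ⋂ₜ Bad(kₜ,n,m)` and `C ⊂ ℝⁿ` is an everywhere non-degenerate `C¹` curve, then
`dim_H (⋂ₜ Bad_Θ(kₜ,n,m) ∩ C) = 1`. -/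
theorem iInter_badT_inter_curve_dimH {n m : ℕ} (hn : 0 < n) (hm : 0 < m)
    (k : ℕ → Fin n → ℝ) (hk : ∀ t, IsWeight (k t))
    (Θ : Matrix (Fin n) (Fin m) ℝ) (hΘ : ∀ t, Θ ∈ Bad n m (k t))
    (a b : ℝ) (hab : a < b)
    (f f' : ℝ → Fin n → ℝ)
    (hderiv : ∀ x ∈ Set.Icc a b, HasDerivWithinAt f (f' x) (Set.Icc a b) x)
    (hcont : ContinuousOn f' (Set.Icc a b))
    (hnd : ∀ x ∈ Set.Icc a b, ∀ i, f' x i ≠ 0) :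
    dimH ((⋂ t, BadT n m (k t) Θ) ∩ f '' Set.Icc a b) = 1 := by
  obtain ⟨μ, hμ, M, hM, hlow, hupp⟩ := exists_biLipschitz_coordinates hderiv hcont hnd
  let E : ℕ → Set ℝ := fun t => {x | x ∈ Set.Icc a b → f x ∈ BadT n m (k t) Θ}
  have hE : ∀ t, AvoidanceWinning (E t) := fun t =>
    avoidanceWinning_badT hn hm (hk t) (hΘ t) hμ hM hlow hupp
  have himage : (⋂ t, BadT n m (k t) Θ) ∩ f '' Set.Icc a b = f '' ((⋂ t, E t) ∩ Set.Icc a b) := by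
    ext y
    constructor
    · rintro ⟨hy, x, hx, rfl⟩
      exact ⟨x, ⟨Set.mem_iInter.2 fun t _ => Set.mem_iInter.1 hy t, hx⟩, rfl⟩
    · rintro ⟨x, ⟨hxE, hx⟩, rfl⟩
      exact ⟨Set.mem_iInter.2 fun t => Set.mem_iInter.1 hxE t hx, x, hx, rfl⟩
  rw [himage, dimH_image_eq_of_biLipschitzOn (M := M) hμ]
  · refine le_antisymm ?_ (one_le_dimH_iInter_of_avoidanceWinning hE hab)
    exact (dimH_mono (Set.subset_univ _)).trans_eq Real.dimH_univ
  · intro x hx y hy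
    exact (hlow x hx.2 y hy.2 ⟨0, hn⟩).trans (dist_le_pi_dist (f x) (f y) ⟨0, hn⟩)
  · intro x hx y hy
    exact (dist_pi_le_iff (by positivity)).2 fun i => hupp x hx.2 y hy.2 i
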